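/- arXiv:1504.06804 — 7 statements merged into one kernel-verified Lean document; each statement's English description precedes it below -/
import Mathlib

section
/- Let p be a prime and let m ≤ p. For distinct keys x, y ∈ [p], if a is chosen uniformly at random from [p]₊ = {1,…,p−1} and b is chosen independently and uniformly at random from [p] = {0,…,p−1}, then the probability that ((ax+b) mod p) mod m = ((ay+b) mod p) mod m is at most 1/m. That is, the multiply-mod-prime family h_{a,b}(x) = ((ax+b) mod p) mod m is universal. -/
lemma fiber_card_bound (p m q : ℕ) (hm : 0 < m) (hq : q < p) :
    (((Finset.range p).filter (fun r => q % m = r % m)).erase q).card ≤ (p - 1) / m := by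
  rw [Finset.card_erase_of_mem (by simp [hq])]
  have h : ((Finset.range p).filter (fun r => q % m = r % m)).card
      ≤ (Finset.range ((p - 1) / m + 1)).card := by
    apply Finset.card_le_card_of_injOn (fun r => r / m)
    · intro r hr
      simp only [Finset.coe_filter, Finset.mem_range, Set.mem_ofPred_eq] at hr
      simp only [Finset.coe_range, Set.mem_Iio]
      exact Nat.lt_succ_of_le (Nat.div_le_div_right (by omega))
    · intro r hr s hs hrs
      simp only [Finset.coe_filter, Finset.mem_range, Set.mem_ofPred_eq] at hr hs
      simp only at hrs
      rw [← Nat.div_add_mod r m, ← Nat.div_add_mod s m, hrs, ← hr.2, ← hs.2]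
  rw [Finset.card_range] at h
  exact Nat.sub_le_of_le_add h

lemma zmod_cast_inj_of_lt (p a b : ℕ) (ha : a < p) (hb : b < p)
    (h : (a : ZMod p) = b) : a = b := by
  have h1 := (ZMod.natCast_eq_natCast_iff' a b p).1 h
  rwa [Nat.mod_eq_of_lt ha, Nat.mod_eq_of_lt hb] at h1

lemma collision_count_bound (p m : ℕ) (hp : p.Prime) (hm : 0 < m)
    (x y : ℕ) (hx : x < p) (hy : y < p) (hxy : x ≠ y) :
    ((Finset.Ico 1 p ×ˢ Finset.range p).filter
        (fun ab => ((ab.1 * x + ab.2) % p) % m = ((ab.1 * y + ab.2) % p) % m)).card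
      ≤ p * ((p - 1) / m) := by
  have : Fact p.Prime := ⟨hp⟩
  have hxy0 : (x : ZMod p) - y ≠ 0 := fun h =>
    hxy (zmod_cast_inj_of_lt p x y hx hy (sub_eq_zero.1 h))
  have key : ((Finset.Ico 1 p ×ˢ Finset.range p).filter
        (fun ab => ((ab.1 * x + ab.2) % p) % m = ((ab.1 * y + ab.2) % p) % m)).card
      ≤ ((Finset.range p).sigma (fun q =>
          ((Finset.range p).filter (fun r => q % m = r % m)).erase q)).card := by
    apply Finset.card_le_card_of_injOn
      (fun ab => (⟨(ab.1 * x + ab.2) % p, (ab.1 * y + ab.2) % p⟩ : Σ _ : ℕ, ℕ))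
    · rintro ⟨a, b⟩ hab
      simp only [Finset.coe_filter, Finset.mem_product, Finset.mem_Ico, Finset.mem_range,
        Set.mem_ofPred_eq] at hab
      obtain ⟨⟨⟨ha1, hap⟩, hb⟩, hc⟩ := hab
      simp only [Finset.mem_coe, Finset.mem_sigma, Finset.mem_erase, Finset.mem_filter,
        Finset.mem_range]
      refine ⟨Nat.mod_lt _ hp.pos, ?_, Nat.mod_lt _ hp.pos, hc⟩
      intro h
      have h1 := (ZMod.natCast_eq_natCast_iff' _ _ p).2 h
      push_cast at h1
      have h2 : (a : ZMod p) * ((x : ZMod p) - y) = 0 := by linear_combination -h1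
      have h3 : (a : ZMod p) = (0 : ℕ) := by
        simpa using (mul_eq_zero.1 h2).resolve_right hxy0
      have := zmod_cast_inj_of_lt p a 0 hap hp.pos h3
      omega
    · rintro ⟨a, b⟩ hab ⟨c, d⟩ hcd h
      simp only [Finset.coe_filter, Finset.mem_product, Finset.mem_Ico, Finset.mem_range,
        Set.mem_ofPred_eq] at hab hcd
      simp only [Sigma.mk.injEq, heq_eq_eq] at h
      have h1 := (ZMod.natCast_eq_natCast_iff' _ _ p).2 h.1
      have h2 := (ZMod.natCast_eq_natCast_iff' _ _ p).2 h.2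
      push_cast at h1 h2
      have h3 : ((a : ZMod p) - c) * ((x : ZMod p) - y) = 0 := by linear_combination h1 - h2
      have h4 : (a : ZMod p) = c := sub_eq_zero.1 ((mul_eq_zero.1 h3).resolve_right hxy0)
      have h5 : (b : ZMod p) = d := by linear_combination h1 - (x : ZMod p) * h4
      rw [zmod_cast_inj_of_lt p a c hab.1.1.2 hcd.1.1.2 h4,
        zmod_cast_inj_of_lt p b d hab.1.2 hcd.1.2 h5]
  refine key.trans ?_
  rw [Finset.card_sigma]
  refine (Finset.sum_le_card_nsmul _ _ ((p - 1) / m) ?_).trans (by simp)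
  intro q hq
  exact fiber_card_bound p m q hm (Finset.mem_range.1 hq)

/-- Multiply-mod-prime hashing `h_{a,b}(x) = ((a*x + b) mod p) mod m`
with `a` uniform in `{1,…,p−1}` and `b` uniform in `{0,…,p−1}` is universal:
for distinct `x, y ∈ [p]` the collision probability is at most `1/m`. -/
theorem multiply_mod_prime_universal (p m : ℕ) (hp : p.Prime) (hm : 0 < m) (hmp : m ≤ p)
    (x y : ℕ) (hx : x < p) (hy : y < p) (hxy : x ≠ y) :
    (((Finset.Ico 1 p ×ˢ Finset.range p).filter
        (fun ab => ((ab.1 * x + ab.2) % p) % m = ((ab.1 * y + ab.2) % p) % m)).card : ℚ)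
      / ((Finset.Ico 1 p ×ˢ Finset.range p).card : ℚ) ≤ 1 / m := by
  have h := collision_count_bound p m hp hm x y hx hy hxy
  have h2 : (p - 1) / m * m ≤ p - 1 := Nat.div_mul_le_self _ _
  have hp2 := hp.two_le
  have hcard : (Finset.Ico 1 p ×ˢ Finset.range p).card = (p - 1) * p := by simp
  rw [hcard, div_le_div_iff₀ (by
    exact_mod_cast Nat.mul_pos (by omega) hp.pos) (by exact_mod_cast hm), one_mul]
  norm_cast
  calc _ ≤ p * ((p - 1) / m) * m := Nat.mul_le_mul_right _ h
    _ = p * ((p - 1) / m * m) := by ring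
    _ ≤ p * (p - 1) := Nat.mul_le_mul_left _ h2
    _ = (p - 1) * p := by ring
end

section
/- Let w and ℓ be positive integers with ℓ ≤ w. For a an odd integer chosen uniformly at random from the odd numbers in [2^w], define h_a : [2^w] → [2^ℓ] by h_a(x) = ⌊(ax mod 2^w)/2^{w−ℓ}⌋. Then for any two distinct keys x, y ∈ [2^w], Pr[h_a(x) = h_a(y)] ≤ 2/2^ℓ. That is, the multiply-shift family is 2-universal. -/
lemma ms_collide (w ℓ s z x y a : ℕ) (hℓw : ℓ ≤ w) (hsw : s < w) (hd : x = y + 2 ^ s * z)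
    (h : a * x % 2 ^ w / 2 ^ (w - ℓ) = a * y % 2 ^ w / 2 ^ (w - ℓ)) :
    ∃ f k : ℤ, (a : ℤ) * z = f + 2 ^ (w - s) * k ∧ 2 ^ s * |f| < 2 ^ (w - ℓ) := by
  have hp := Nat.mod_add_div (a * x) (2 ^ w)
  have hq := Nat.mod_add_div (a * y) (2 ^ w)
  generalize a * x % 2 ^ w = p at *
  generalize a * y % 2 ^ w = q at *
  generalize a * x / 2 ^ w = u at *
  generalize a * y / 2 ^ w = v at *
  have hK : 0 < 2 ^ (w - ℓ) := by positivity
  have h1 := Nat.mod_add_div p (2 ^ (w - ℓ))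
  have h2 := Nat.mod_add_div q (2 ^ (w - ℓ))
  have h3 := Nat.mod_lt p hK
  have h4 := Nat.mod_lt q hK
  rw [h] at h1
  have hN : (2 : ℤ) ^ w = 2 ^ s * 2 ^ (w - s) := by rw [← pow_add]; congr 1; omega
  have e : (2 : ℤ) ^ s * (a * z) = (p - q) + 2 ^ w * ((u : ℤ) - v) := by
    subst hd
    zify at hp hq
    linear_combination hq - hp
  have habs : |(p : ℤ) - q| < 2 ^ (w - ℓ) := by
    zify at h1 h2 h3 h4
    have := Int.emod_nonneg (p : ℤ) (b := 2 ^ (w - ℓ)) (by positivity)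
    have := Int.emod_nonneg (q : ℤ) (b := 2 ^ (w - ℓ)) (by positivity)
    rw [abs_lt]; constructor <;> linarith
  refine ⟨a * z - 2 ^ (w - s) * ((u : ℤ) - v), (u : ℤ) - v, by ring, ?_⟩
  have e2 : (2 : ℤ) ^ s * (a * z - 2 ^ (w - s) * ((u : ℤ) - v)) = p - q := by
    rw [hN] at e; linear_combination e
  rw [← e2, abs_mul, abs_of_pos (by positivity : (0 : ℤ) < 2 ^ s)] at habs
  exact habs

lemma ms_card (w ℓ : ℕ) (hℓ : 0 < ℓ) (hℓw : ℓ ≤ w)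
    (x y : ℕ) (hx : x < 2 ^ w) (hxy : y < x) :
    (((Finset.range (2 ^ w)).filter (fun a => a % 2 = 1)).filter
        (fun a => a * x % 2 ^ w / 2 ^ (w - ℓ) = a * y % 2 ^ w / 2 ^ (w - ℓ))).card
      ≤ 2 ^ (w - ℓ) := by
  obtain ⟨s, z, hz, hd⟩ := Nat.exists_eq_two_pow_mul_odd (n := x - y) (by omega)
  have hd' : x = y + 2 ^ s * z := by omega
  have hsw : s < w := by
    have : 2 ^ s < 2 ^ w := by
      have := Nat.le_mul_of_pos_right (2 ^ s) hz.pos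
      omega
    exact (Nat.pow_lt_pow_iff_right (by norm_num)).1 this
  have hN2 : (2 : ℤ) ∣ 2 ^ (w - s) := dvd_pow_self _ (by omega)
  by_cases hs : w - ℓ ≤ s
  · rw [Finset.card_eq_zero.2]
    · positivity
    rw [Finset.eq_empty_iff_forall_notMem]
    intro a ha
    simp only [Finset.mem_filter, Finset.mem_range] at ha
    obtain ⟨⟨_, hao⟩, hc⟩ := ha
    obtain ⟨f, k, h1, h2⟩ := ms_collide w ℓ s z x y a hℓw hsw hd' hc
    have h3 : (2 : ℤ) ^ (w - ℓ) ≤ 2 ^ s := pow_le_pow_right₀ (by norm_num) hs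
    have h4 : |f| < 1 := by
      have : (0 : ℤ) < 2 ^ s := by positivity
      nlinarith
    have h5 : f = 0 := Int.abs_lt_one_iff.1 h4
    have h6 : Odd ((a : ℤ) * z) := by
      exact_mod_cast (Nat.odd_iff.2 hao).mul hz
    rw [h1, h5, zero_add] at h6
    exact (Int.not_even_iff_odd.2 h6) (even_iff_two_dvd.2 (hN2.mul_right k))
  · obtain ⟨r, hr⟩ : ∃ r, w - ℓ = s + r := ⟨w - ℓ - s, by omega⟩
    have hr0 : 0 < r := by omega
    have hcard : (Finset.range (2 ^ s) ×ˢ Finset.range (2 ^ r)).card = 2 ^ (w - ℓ) := by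
      simp [hr, pow_add]
    refine le_of_le_of_eq ?_ hcard
    have hN2' : 2 ∣ 2 ^ (w - s) := dvd_pow_self _ (by omega)
    have hr2 : 2 ∣ 2 ^ r := dvd_pow_self _ (by omega)
    apply Finset.card_le_card_of_injOn
      (fun a => (a / 2 ^ (w - s), (a * z + 2 ^ r) % 2 ^ (w - s) / 2))
    · intro a ha
      simp only [Finset.coe_filter, Finset.mem_filter, Finset.mem_range, Set.mem_ofPred_eq] at ha
      obtain ⟨⟨haw, hao⟩, hc⟩ := ha
      obtain ⟨f, k, h1, h2⟩ := ms_collide w ℓ s z x y a hℓw hsw hd' hc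
      simp only [Finset.coe_product, Set.mem_prod, Finset.coe_range, Set.mem_Iio]
      constructor
      · apply Nat.div_lt_of_lt_mul
        rw [← pow_add]
        convert haw using 2
        omega
      · rw [hr, pow_add] at h2
        have h3 : |f| < 2 ^ r := lt_of_mul_lt_mul_left h2 (by positivity)
        rw [abs_lt] at h3
        have h4 : (2 : ℤ) ^ (r + 1) ≤ 2 ^ (w - s) := pow_le_pow_right₀ (by norm_num) (by omega)
        rw [pow_succ] at h4
        have h5 : ((a : ℤ) * z + 2 ^ r) % 2 ^ (w - s) = f + 2 ^ r := by
          rw [h1, show f + 2 ^ (w - s) * k + 2 ^ r = f + 2 ^ r + 2 ^ (w - s) * k by ring,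
            Int.add_mul_emod_self_left]
          exact Int.emod_eq_of_lt (by linarith) (by linarith)
        have h6 : (((a * z + 2 ^ r) % 2 ^ (w - s) : ℕ) : ℤ) < 2 ^ r * 2 := by
          push_cast
          linarith
        have h7 : (a * z + 2 ^ r) % 2 ^ (w - s) < 2 ^ r * 2 := by exact_mod_cast h6
        exact Nat.div_lt_of_lt_mul (by linarith)
    · intro a ha b hb hab
      simp only [Finset.coe_filter, Finset.mem_filter, Finset.mem_range, Set.mem_ofPred_eq] at ha hb
      simp only [Prod.mk.injEq] at hab
      obtain ⟨h1, h2⟩ := hab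
      have key : ∀ c, c % 2 = 1 → (c * z + 2 ^ r) % 2 ^ (w - s) % 2 = 1 := by
        intro c hc
        rw [Nat.mod_mod_of_dvd _ hN2']
        have := Nat.odd_iff.1 ((Nat.odd_iff.2 hc).mul hz)
        omega
      have ka := key a ha.1.2
      have kb := key b hb.1.2
      have h3 : a * z + 2 ^ r ≡ b * z + 2 ^ r [MOD 2 ^ (w - s)] := by
        unfold Nat.ModEq; omega
      have h4 := Nat.ModEq.add_right_cancel' _ h3
      have hcop : Nat.gcd (2 ^ (w - s)) z = 1 :=
        Nat.Coprime.pow_left _ (Nat.coprime_two_left.2 hz)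
      have h5 : a % 2 ^ (w - s) = b % 2 ^ (w - s) := Nat.ModEq.cancel_right_of_coprime hcop h4
      rw [← Nat.mod_add_div a (2 ^ (w - s)), ← Nat.mod_add_div b (2 ^ (w - s)), h1, h5]

lemma ms_odd (w : ℕ) (hw : 0 < w) :
    2 ^ (w - 1) ≤ ((Finset.range (2 ^ w)).filter (fun a => a % 2 = 1)).card := by
  obtain ⟨n, rfl⟩ : ∃ n, w = n + 1 := ⟨w - 1, by omega⟩
  rw [show n + 1 - 1 = n by omega]
  conv_lhs => rw [← Finset.card_range (2 ^ n)]
  apply Finset.card_le_card_of_injOn (fun k => 2 * k + 1)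
  · intro k hk
    simp only [Finset.coe_range, Set.mem_Iio] at hk
    simp only [Finset.coe_filter, Finset.mem_range, Set.mem_ofPred_eq, pow_succ]
    omega
  · intro a _ b _ h
    simp only at h
    omega

/-- Multiply-shift hashing `h_a(x) = ⌊(a*x mod 2^w) / 2^(w−ℓ)⌋`
with `a` uniform among the odd numbers in `[2^w]` is 2-universal: for distinct
`x, y ∈ [2^w]` the collision probability is at most `2/2^ℓ`. -/
theorem multiply_shift_two_universal (w ℓ : ℕ) (hℓ : 0 < ℓ) (hw : 0 < w) (hℓw : ℓ ≤ w)
    (x y : ℕ) (hx : x < 2 ^ w) (hy : y < 2 ^ w) (hxy : x ≠ y) :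
    ((((Finset.range (2 ^ w)).filter (fun a => a % 2 = 1)).filter
        (fun a => a * x % 2 ^ w / 2 ^ (w - ℓ) = a * y % 2 ^ w / 2 ^ (w - ℓ))).card : ℚ)
      / (((Finset.range (2 ^ w)).filter (fun a => a % 2 = 1)).card : ℚ) ≤ 2 / 2 ^ ℓ := by
  have hA : (((Finset.range (2 ^ w)).filter (fun a => a % 2 = 1)).filter
        (fun a => a * x % 2 ^ w / 2 ^ (w - ℓ) = a * y % 2 ^ w / 2 ^ (w - ℓ))).card
      ≤ 2 ^ (w - ℓ) := by
    rcases lt_or_gt_of_ne hxy with h | h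
    · have := ms_card w ℓ hℓ hℓw y x hy h
      simpa only [eq_comm] using this
    · exact ms_card w ℓ hℓ hℓw x y hx h
  have hB := ms_odd w hw
  have hA' := (Nat.cast_le (α := ℚ)).2 hA
  have hB' := (Nat.cast_le (α := ℚ)).2 hB
  push_cast at hA' hB'
  have hpos : (0 : ℚ) < 2 ^ (w - 1) := by positivity
  rw [div_le_div_iff₀ (lt_of_lt_of_le hpos hB') (by positivity)]
  have e1 : (2 : ℚ) ^ (w - ℓ) * 2 ^ ℓ = 2 * 2 ^ (w - 1) := by
    rw [← pow_add, ← pow_succ']; congr 1; omega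
  calc _ ≤ (2 : ℚ) ^ (w - ℓ) * 2 ^ ℓ := by gcongr
    _ = 2 * 2 ^ (w - 1) := e1
    _ ≤ _ := by gcongr
end

section
/- Let p be a prime and m ≤ p. For (a,b) chosen uniformly at random from [p]², the hash function h_{a,b} : [p] → [m] defined by h_{a,b}(x) = ((ax+b) mod p) mod m is strongly 2-universal: for every x ∈ [p] and q ∈ [m], Pr[h_{a,b}(x)=q] ≤ 2/m, and for every pair of distinct keys x,y ∈ [p], the random variables h_{a,b}(x) and h_{a,b}(y) are independent. -/
theorem card_filter_comp_self {α : Type*} [DecidableEq α] (T : Finset α) (f : α → α)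
    (hf : ∀ a ∈ T, f a ∈ T) (hi : Set.InjOn f T) (P : α → Prop) [DecidablePred P] :
    (T.filter (fun a => P (f a))).card = (T.filter P).card := by
  have himg : T.image f = T :=
    Finset.eq_of_subset_of_card_le (Finset.image_subset_iff.2 hf)
      (Finset.card_image_of_injOn hi).ge
  have h : (T.filter (fun a => P (f a))).image f = T.filter P := by
    conv_rhs => rw [← himg]
    rw [Finset.filter_image]
  rw [← h, Finset.card_image_of_injOn]
  exact hi.mono (Finset.coe_subset.2 (Finset.filter_subset _ _))

theorem card_single (p m x q : ℕ) (hp : p.Prime) :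
    ((Finset.range p ×ˢ Finset.range p).filter
      (fun ab => ((ab.1 * x + ab.2) % p) % m = q)).card
    = p * ((Finset.range p).filter (fun u => u % m = q)).card := by
  have h := card_filter_comp_self (Finset.range p ×ˢ Finset.range p)
    (fun ab => (ab.1, (ab.1 * x + ab.2) % p))
    (by
      rintro ⟨a, b⟩ h
      simp only [Finset.mem_product, Finset.mem_range] at h ⊢
      exact ⟨h.1, Nat.mod_lt _ hp.pos⟩)
    (by
      rintro ⟨a, b⟩ h ⟨a', b'⟩ h' e
      simp only [Finset.coe_product, Finset.coe_range, Set.mem_prod, Set.mem_Iio] at h h'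
      simp only [Prod.mk.injEq] at e
      obtain ⟨rfl, e⟩ := e
      have e2 : b ≡ b' [MOD p] := Nat.ModEq.add_left_cancel' _ e
      rw [Nat.ModEq.eq_of_lt_of_lt e2 h.2 h'.2])
    (fun uv => True ∧ uv.2 % m = q)
  simp only [true_and] at h
  rw [h]
  have h2 := Finset.filter_product (s := Finset.range p) (t := Finset.range p)
    (fun _ => True) (fun u => u % m = q)
  simp only [true_and, Finset.filter_true] at h2
  rw [h2, Finset.card_product, Finset.card_range]

theorem card_pair (p m x y q r : ℕ) (hp : p.Prime) (hx : x < p) (hy : y < p) (hxy : x ≠ y) :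
    ((Finset.range p ×ˢ Finset.range p).filter
      (fun ab => ((ab.1 * x + ab.2) % p) % m = q ∧ ((ab.1 * y + ab.2) % p) % m = r)).card
    = ((Finset.range p).filter (fun u => u % m = q)).card
      * ((Finset.range p).filter (fun u => u % m = r)).card := by
  have h := card_filter_comp_self (Finset.range p ×ˢ Finset.range p)
    (fun ab => ((ab.1 * x + ab.2) % p, (ab.1 * y + ab.2) % p))
    (by
      rintro ⟨a, b⟩ h
      simp only [Finset.mem_product, Finset.mem_range]
      exact ⟨Nat.mod_lt _ hp.pos, Nat.mod_lt _ hp.pos⟩)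
    (by
      rintro ⟨a, b⟩ h ⟨a', b'⟩ h' e
      simp only [Finset.coe_product, Finset.coe_range, Set.mem_prod, Set.mem_Iio] at h h'
      simp only [Prod.mk.injEq] at e
      obtain ⟨e1, e2⟩ := e
      haveI : Fact p.Prime := ⟨hp⟩
      have f1 := (ZMod.natCast_eq_natCast_iff _ _ p).2 e1
      have f2 := (ZMod.natCast_eq_natCast_iff _ _ p).2 e2
      push_cast at f1 f2
      have hne : (x : ZMod p) - y ≠ 0 := by
        intro h0
        exact hxy (Nat.ModEq.eq_of_lt_of_lt
          ((ZMod.natCast_eq_natCast_iff _ _ p).1 (sub_eq_zero.1 h0)) hx hy)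
      have ha : (a : ZMod p) = a' := by
        have : ((a : ZMod p) - a') * (x - y) = 0 := by linear_combination f1 - f2
        exact sub_eq_zero.1 ((mul_eq_zero.1 this).resolve_right hne)
      have ha' : a = a' := Nat.ModEq.eq_of_lt_of_lt
          ((ZMod.natCast_eq_natCast_iff _ _ p).1 ha) h.1 h'.1
      subst ha'
      have e2 : b ≡ b' [MOD p] := Nat.ModEq.add_left_cancel' _ e1
      rw [Nat.ModEq.eq_of_lt_of_lt e2 h.2 h'.2])
    (fun uv => uv.1 % m = q ∧ uv.2 % m = r)
  rw [h, Finset.filter_product (s := Finset.range p) (t := Finset.range p)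
    (fun u => u % m = q) (fun u => u % m = r), Finset.card_product]

theorem card_residue (p m q : ℕ) (hm : 0 < m) (hmp : m ≤ p) (hq : q < m) :
    ((Finset.range p).filter (fun u => u % m = q)).card * m ≤ 2 * p := by
  have h := Nat.count_modEq_card p hm q
  rw [Nat.count_eq_card_filter_range] at h
  simp only [Nat.ModEq, Nat.mod_eq_of_lt hq] at h
  have h1 : ((Finset.range p).filter (fun u => u % m = q)).card ≤ p / m + 1 := by
    rw [h]; split_ifs <;> omega
  have h2 := Nat.div_mul_le_self p m
  nlinarith

/-- For `(a, b)` uniform in `[p]²`, the hash function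
`h_{a,b}(x) = ((a*x + b) mod p) mod m` from `[p]` to `[m]` (with `m ≤ p`) is strongly
2-universal: it is 2-uniform (every value is attained with probability at most `2/m`)
and any two distinct keys hash independently. -/
theorem multiply_mod_prime_strongly_two_universal (p m : ℕ) (hp : p.Prime)
    (hm : 0 < m) (hmp : m ≤ p) :
    (∀ x, x < p → ∀ q, q < m →
      (((Finset.range p ×ˢ Finset.range p).filter
          (fun ab => ((ab.1 * x + ab.2) % p) % m = q)).card : ℚ)
        / ((Finset.range p ×ˢ Finset.range p).card : ℚ) ≤ 2 / m) ∧
    (∀ x y, x < p → y < p → x ≠ y → ∀ q r, q < m → r < m →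
      (((Finset.range p ×ˢ Finset.range p).filter
          (fun ab => ((ab.1 * x + ab.2) % p) % m = q ∧ ((ab.1 * y + ab.2) % p) % m = r)).card : ℚ)
        / ((Finset.range p ×ˢ Finset.range p).card : ℚ)
      = ((((Finset.range p ×ˢ Finset.range p).filter
            (fun ab => ((ab.1 * x + ab.2) % p) % m = q)).card : ℚ)
          / ((Finset.range p ×ˢ Finset.range p).card : ℚ))
        * ((((Finset.range p ×ˢ Finset.range p).filter
            (fun ab => ((ab.1 * y + ab.2) % p) % m = r)).card : ℚ)
          / ((Finset.range p ×ˢ Finset.range p).card : ℚ))) := by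
  have hp0 : (p : ℚ) ≠ 0 := by exact_mod_cast hp.ne_zero
  have hpp : (0 : ℚ) < p := by exact_mod_cast hp.pos
  have hmm : (0 : ℚ) < m := by exact_mod_cast hm
  refine ⟨fun x hx q hq => ?_, fun x y hx hy hxy q r hq hr => ?_⟩
  · rw [card_single p m x q hp, Finset.card_product, Finset.card_range]
    have h : ((((Finset.range p).filter (fun u => u % m = q)).card : ℕ) : ℚ) * m ≤ 2 * p := by
      exact_mod_cast card_residue p m q hm hmp hq
    push_cast
    rw [mul_div_mul_left _ _ hp0, div_le_div_iff₀ hpp hmm]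
    exact h
  · rw [card_single p m x q hp, card_single p m y r hp, card_pair p m x y q r hp hx hy hxy,
      Finset.card_product, Finset.card_range]
    push_cast
    field_simp
end

section
/- Let w, ℓ be positive integers and let w̄ ≥ w + ℓ − 1. For a and b chosen independently and uniformly at random from [2^w̄], the multiply-shift function h_{a,b} : [2^w] → [2^ℓ] defined by h_{a,b}(x) = (ax+b)[w̄−ℓ, w̄) is strongly universal: for any distinct x,y ∈ [2^w] and any q,r ∈ [2^ℓ], Pr[h_{a,b}(x)=q ∧ h_{a,b}(y)=r] = 1/2^{2ℓ}. -/
/-- Existence of a translation moving the two affine values by prescribed multiples of `M`. -/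
theorem ms_shift (w ℓ wb : ℕ) (hw : 0 < w) (hℓ : 0 < ℓ) (hwb : w + ℓ - 1 ≤ wb)
    (x y : ℕ) (hx : x < 2 ^ w) (hy : y < 2 ^ w) (hxy : x ≠ y) (α β : ℕ) :
    ∃ t u : ℕ, t * x + u ≡ α * 2 ^ (wb - ℓ) [MOD 2 ^ wb] ∧
      t * y + u ≡ β * 2 ^ (wb - ℓ) [MOD 2 ^ wb] := by
  have hd0 : (y : ℤ) - x ≠ 0 := by omega
  have hg : (Int.gcd ((y : ℤ) - x) ((2 ^ wb : ℕ) : ℤ)) ∣ 2 ^ (wb - ℓ) := by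
    have h2 : (Int.gcd ((y : ℤ) - x) ((2 ^ wb : ℕ) : ℤ)) ∣ 2 ^ wb := by
      have := Int.gcd_dvd_right ((y : ℤ) - x) ((2 ^ wb : ℕ) : ℤ)
      exact_mod_cast this
    obtain ⟨s, hs, hgs⟩ := (Nat.dvd_prime_pow Nat.prime_two).1 h2
    rw [hgs]
    apply pow_dvd_pow
    have h3 : (Int.gcd ((y : ℤ) - x) ((2 ^ wb : ℕ) : ℤ)) ∣ ((y : ℤ) - x).natAbs := by
      have := Int.gcd_dvd_left ((y : ℤ) - x) ((2 ^ wb : ℕ) : ℤ)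
      exact Int.natCast_dvd.1 this
    have h4 := Nat.le_of_dvd (by omega) h3
    rw [hgs] at h4
    have h5 : 2 ^ s < 2 ^ w := by omega
    have := (Nat.pow_lt_pow_iff_right (by norm_num : 1 < 2)).1 h5
    omega
  obtain ⟨m, hm⟩ := hg
  have hbez := Int.gcd_eq_gcd_ab ((y : ℤ) - x) ((2 ^ wb : ℕ) : ℤ)
  generalize Int.gcd ((y : ℤ) - x) ((2 ^ wb : ℕ) : ℤ) = g at hm hbez
  generalize Int.gcdA ((y : ℤ) - x) ((2 ^ wb : ℕ) : ℤ) = A at hbez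
  generalize Int.gcdB ((y : ℤ) - x) ((2 ^ wb : ℕ) : ℤ) = B at hbez
  have hN : 0 < 2 ^ wb := by positivity
  generalize 2 ^ wb = N at *
  generalize 2 ^ (wb - ℓ) = M at *
  have key : ∀ t : ℤ, ∃ n : ℕ, (n : ZMod N) = (t : ZMod N) := by
    intro t
    have h0 := Int.emod_nonneg t (by omega : (N : ℤ) ≠ 0)
    obtain ⟨n, hn⟩ := Int.eq_ofNat_of_zero_le h0
    refine ⟨n, ?_⟩
    have : ((t % (N : ℤ) : ℤ) : ZMod N) = (t : ZMod N) := by simp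
    rw [← this, hn]; simp
  obtain ⟨t, ht⟩ := key (((β : ℤ) - α) * A * m)
  obtain ⟨u, hu⟩ := key ((α : ℤ) * M - ((β : ℤ) - α) * A * m * x)
  refine ⟨t, u, ?_, ?_⟩
  · rw [← ZMod.natCast_eq_natCast_iff]
    push_cast at *
    rw [ht, hu]; ring
  · rw [← ZMod.natCast_eq_natCast_iff]
    have hb := congrArg (Int.cast : ℤ → ZMod N) hbez
    have hm' := congrArg (Nat.cast : ℕ → ZMod N) hm
    push_cast at *
    simp only [ZMod.natCast_self, zero_mul, add_zero] at hb
    rw [ht, hu, hm', hb]; ring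

/-- The fiber of the hash pair. -/
def msFiber (N M x y q r : ℕ) : Finset (ℕ × ℕ) :=
  (Finset.range N ×ˢ Finset.range N).filter
        (fun ab => (ab.1 * x + ab.2) % N / M = q ∧ (ab.1 * y + ab.2) % N / M = r)

theorem ms_top (M L z z' α q q' : ℕ) (hM : 0 < M) (hq : q < L) (hq' : q' < L)
    (hα : α = q' + (L - q)) (h : z' ≡ z + α * M [MOD M * L])
    (hz : z % (M * L) / M = q) : z' % (M * L) / M = q' := by
  rw [h, Nat.mod_mul_right_div_self, Nat.add_mul_div_right _ _ hM]
  rw [Nat.mod_mul_right_div_self] at hz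
  rw [Nat.add_mod, hz, Nat.add_mod_mod]
  · have : q + α = q' + L := by omega
    rw [this, Nat.add_mod_right, Nat.mod_eq_of_lt hq']

theorem ms_le (N M L x y : ℕ) (hM : 0 < M) (hL : 0 < L) (hN : N = M * L)
    (hs : ∀ α β : ℕ, ∃ t u : ℕ, t * x + u ≡ α * M [MOD N] ∧ t * y + u ≡ β * M [MOD N])
    (q r q' r' : ℕ) (hq : q < L) (hr : r < L) (hq' : q' < L) (hr' : r' < L) :
    (msFiber N M x y q r).card ≤ (msFiber N M x y q' r').card := by
  have hN0 : 0 < N := by rw [hN]; positivity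
  obtain ⟨t, u, h1, h2⟩ := hs (q' + (L - q)) (r' + (L - r))
  have aux : ∀ (x α a b : ℕ), t * x + u ≡ α * M [MOD N] →
      (a + t) % N * x + (b + u) % N ≡ a * x + b + α * M [MOD N] := by
    intro x α a b h
    calc (a + t) % N * x + (b + u) % N ≡ (a + t) * x + (b + u) [MOD N] :=
          ((Nat.mod_modEq _ _).mul_right _).add (Nat.mod_modEq _ _)
      _ = a * x + b + (t * x + u) := by ring
      _ ≡ _ [MOD N] := h.add_left _
  apply Finset.card_le_card_of_injOn (fun p => ((p.1 + t) % N, (p.2 + u) % N))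
  · rintro ⟨a, b⟩ hab
    simp only [msFiber, Finset.coe_filter, Finset.mem_product, Finset.mem_range,
      Set.mem_ofPred_eq] at hab ⊢
    refine ⟨⟨Nat.mod_lt _ hN0, Nat.mod_lt _ hN0⟩, ?_, ?_⟩
    · subst hN
      exact ms_top M L _ _ _ q q' hM hq hq' rfl (aux x _ a b h1) hab.2.1
    · subst hN
      exact ms_top M L _ _ _ r r' hM hr hr' rfl (aux y _ a b h2) hab.2.2
  · rintro ⟨a, b⟩ hab ⟨c, d⟩ hcd h
    simp only [msFiber, Finset.coe_filter, Finset.mem_product, Finset.mem_range,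
      Set.mem_ofPred_eq] at hab hcd
    simp only [Prod.mk.injEq] at h ⊢
    exact ⟨(Nat.ModEq.add_right_cancel' t h.1).eq_of_lt_of_lt hab.1.1 hcd.1.1,
      (Nat.ModEq.add_right_cancel' u h.2).eq_of_lt_of_lt hab.1.2 hcd.1.2⟩

theorem ms_count (N M L x y : ℕ) (hM : 0 < M) (hL : 0 < L) (hN : N = M * L)
    (hs : ∀ α β : ℕ, ∃ t u : ℕ, t * x + u ≡ α * M [MOD N] ∧ t * y + u ≡ β * M [MOD N])
    (q r : ℕ) (hq : q < L) (hr : r < L) :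
    (L * L) * (msFiber N M x y q r).card = N * N := by
  have hN0 : 0 < N := by rw [hN]; positivity
  have hlt : ∀ z, z % N / M < L := fun z => by
    rw [Nat.div_lt_iff_lt_mul hM, mul_comm, ← hN]; exact Nat.mod_lt _ hN0
  have h := Finset.card_eq_sum_card_fiberwise
    (s := Finset.range N ×ˢ Finset.range N) (t := Finset.range L ×ˢ Finset.range L)
    (f := fun ab : ℕ × ℕ => ((ab.1 * x + ab.2) % N / M, (ab.1 * y + ab.2) % N / M))
    (by
      rintro ⟨a, b⟩ _
      simp [hlt])
  rw [Finset.sum_congr rfl (g := fun _ => (msFiber N M x y q r).card)] at h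
  · simpa using h.symm
  · rintro ⟨q', r'⟩ h'
    simp only [Finset.mem_product, Finset.mem_range] at h'
    have e := le_antisymm
      (ms_le N M L x y hM hL hN hs q' r' q r h'.1 h'.2 hq hr)
      (ms_le N M L x y hM hL hN hs q r q' r' hq hr h'.1 h'.2)
    rw [← e]
    simp [msFiber, Prod.ext_iff]


/-- Strongly universal multiply-shift: for `w̄ ≥ w + ℓ − 1` and
`(a, b)` uniform in `[2^w̄]²`, the function `h_{a,b}(x) = (a*x + b)[w̄−ℓ, w̄)`
(bits `w̄−ℓ,…,w̄−1` of `a*x + b`) from `[2^w]` to `[2^ℓ]` is strongly universal: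
for distinct `x, y` and any `q, r ∈ [2^ℓ]`,
`Pr[h(x) = q ∧ h(y) = r] = 1/2^(2ℓ)`. -/
theorem multiply_shift_strongly_universal (w ℓ wb : ℕ) (hw : 0 < w) (hℓ : 0 < ℓ)
    (hwb : w + ℓ - 1 ≤ wb)
    (x y : ℕ) (hx : x < 2 ^ w) (hy : y < 2 ^ w) (hxy : x ≠ y)
    (q r : ℕ) (hq : q < 2 ^ ℓ) (hr : r < 2 ^ ℓ) :
    (((Finset.range (2 ^ wb) ×ˢ Finset.range (2 ^ wb)).filter
        (fun ab => (ab.1 * x + ab.2) % 2 ^ wb / 2 ^ (wb - ℓ) = q ∧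
                   (ab.1 * y + ab.2) % 2 ^ wb / 2 ^ (wb - ℓ) = r)).card : ℚ)
      / ((Finset.range (2 ^ wb) ×ˢ Finset.range (2 ^ wb)).card : ℚ)
      = 1 / 2 ^ (2 * ℓ) := by
  have hwl : wb - ℓ + ℓ = wb := by omega
  have h := ms_count (2 ^ wb) (2 ^ (wb - ℓ)) (2 ^ ℓ) x y (by positivity) (by positivity)
    (by rw [← pow_add, hwl]) (ms_shift w ℓ wb hw hℓ hwb x y hx hy hxy) q r hq hr
  unfold msFiber at h
  have h' := congrArg (Nat.cast : ℕ → ℚ) h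
  rw [div_eq_div_iff (by simp) (by positivity)]
  rw [Finset.card_product, Finset.card_range, two_mul, pow_add, one_mul]
  push_cast at h' ⊢
  linarith
end

section
/- Let w, ℓ be positive integers and w̄ ≥ w + ℓ − 1. Let g : U → [2^w̄] be a random function with the property that for any distinct keys x, y ∈ U there exists an s < w, determined by x and y only (not by the randomness of g), such that (g(y)−g(x))[0,s) = 0 while (g(y)−g(x))[s, w̄) is uniformly distributed in [2^{w̄−s}]. Let b be uniform in [2^w̄] and independent of g, and define h_{g,b} : U → [2^ℓ] by h_{g,b}(x) = (g(x)+b)[w̄−ℓ, w̄). Then h_{g,b} is strongly universal. -/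
open MeasureTheory ProbabilityTheory

lemma aux_split {Ω : Type*} [MeasurableSpace Ω] (μ : Measure Ω) (X : Ω → ℕ) (hX : Measurable X)
    (n : ℕ) (hn : ∀ ω, X ω < n) (S : Set Ω) :
    μ S = ∑ u ∈ Finset.range n, μ {ω | X ω = u ∧ ω ∈ S} := by
  have h := sum_measure_preimage_singleton (μ := μ.restrict S) (Finset.range n) (f := X)
    (fun y _ => hX (measurableSet_singleton y))
  have h2 : X ⁻¹' (↑(Finset.range n) : Set ℕ) = Set.univ := by
    ext ω; simp [hn ω]
  rw [h2, Measure.restrict_apply_univ] at h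
  rw [← h]
  refine Finset.sum_congr rfl fun u _ => ?_
  rw [Measure.restrict_apply (hX (measurableSet_singleton u))]
  rfl

lemma aux_count0 (L R r : ℕ) (hL : 0 < L) (hr : r < R) :
    ((Finset.range (L * R)).filter (fun e => e / L = r)).card = L := by
  have : (Finset.range (L * R)).filter (fun e => e / L = r) = Finset.Ico (r * L) (r * L + L) := by
    ext e
    simp only [Finset.mem_filter, Finset.mem_range, Finset.mem_Ico]
    rw [Nat.div_eq_iff hL]
    have : r * L + L ≤ L * R := by nlinarith
    constructor
    · rintro ⟨h1, h2, h3⟩; constructor <;> omega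
    · rintro ⟨h1, h2⟩; refine ⟨?_, ?_, ?_⟩ <;> omega
  rw [this]; simp

lemma aux_count (L R r c : ℕ) (hL : 0 < L) (hr : r < R) :
    ((Finset.range (L * R)).filter (fun e => ((c + e) % (L * R)) / L = r)).card = L := by
  have hp : Function.Periodic (fun e => (e % (L * R)) / L = r) (L * R) := by
    intro e; simp
  have h1 := Nat.filter_Ico_card_eq_of_periodic c (L * R) (fun e => (e % (L * R)) / L = r) hp
  have h0 := Nat.filter_Ico_card_eq_of_periodic 0 (L * R) (fun e => (e % (L * R)) / L = r) hp
  have h2 : ((Finset.range (L * R)).filter (fun e => (e % (L * R)) / L = r)).card = L := by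
    refine Eq.trans ?_ (aux_count0 L R r hL hr)
    apply congrArg Finset.card
    ext e
    simp only [Finset.mem_filter, Finset.mem_range]
    exact and_congr_right fun he => by rw [Nat.mod_eq_of_lt he]
  rw [zero_add, ← Finset.range_eq_Ico, h2] at h0
  rw [← h0] at h1
  refine Eq.trans ?_ h1
  refine Finset.card_bij (fun e _ => c + e) ?_ ?_ ?_
  · intro e he; simp only [Finset.mem_filter, Finset.mem_range, Finset.mem_Ico] at he ⊢
    exact ⟨⟨by omega, by omega⟩, he.2⟩
  · intro a _ b _ h; exact Nat.add_left_cancel h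
  · intro z hz
    simp only [Finset.mem_filter, Finset.mem_range, Finset.mem_Ico] at hz ⊢
    refine ⟨z - c, ⟨by omega, ?_⟩, by omega⟩
    rw [Nat.add_sub_cancel' hz.1.1]; exact hz.2

lemma aux_reduce (t K L a e : ℕ) (ht : 0 < t) :
    (a + t * e) % (t * K) / (t * L) = ((a / t + e) % K) / L := by
  rw [← Nat.div_div_eq_div_mul, Nat.mod_mul_right_div_self, Nat.add_mul_div_left _ _ ht]

lemma aux_inv (N u v a : ℕ) (hu : u < N) (hv : v < N) (ha : a < N) :
    (u + v) % N = a ↔ v = (a + N - u) % N := by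
  rcases lt_or_ge (u + v) N with h | h
  · rw [Nat.mod_eq_of_lt h]
    rcases lt_or_ge a u with h' | h'
    · rw [Nat.mod_eq_of_lt (by omega)]; omega
    · rw [show a + N - u = (a - u) + N by omega, Nat.add_mod_right, Nat.mod_eq_of_lt (by omega)]
      omega
  · rw [show u + v = (u + v - N) + N by omega, Nat.add_mod_right, Nat.mod_eq_of_lt (by omega)]
    rcases lt_or_ge a u with h' | h'
    · rw [Nat.mod_eq_of_lt (by omega)]; omega
    · rw [show a + N - u = (a - u) + N by omega, Nat.add_mod_right, Nat.mod_eq_of_lt (by omega)]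
      omega

lemma aux_shift (N gx gy b : ℕ) (hx : gx < N) :
    ((gx + b) % N + (gy + N - gx) % N) % N = (gy + b) % N := by
  rw [← Nat.add_mod, show gx + b + (gy + N - gx) = gy + b + N by omega, Nat.add_mod_right]

/-- Let `w̄ ≥ w + ℓ − 1`, and let `g : U → [2^w̄]` be a random
function such that for any distinct keys `x, y` there is an `s < w`, determined by
`x` and `y` only, with `(g(y) − g(x))[0, s) = 0` (always) and `(g(y) − g(x))[s, w̄)`
uniform in `[2^(w̄−s)]` (differences taken modulo `2^w̄`). If `b` is uniform in
`[2^w̄]` and independent of `g`, then `h_{g,b}(x) = (g(x) + b)[w̄−ℓ, w̄)` is strongly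
universal. -/
theorem shift_strongly_universal_lemma
    {Ω U : Type*} [MeasureSpace Ω] [IsProbabilityMeasure (ℙ : Measure Ω)]
    (w ℓ wb : ℕ) (hw : 0 < w) (hℓ : 0 < ℓ) (hwb : w + ℓ - 1 ≤ wb)
    (g : Ω → U → ℕ) (b : Ω → ℕ)
    (hg_range : ∀ ω x, g ω x < 2 ^ wb) (hb_range : ∀ ω, b ω < 2 ^ wb)
    (hg_meas : Measurable g) (hb_meas : Measurable b)
    (hb_unif : ∀ v, v < 2 ^ wb → ℙ {ω | b ω = v} = 1 / (2 ^ wb : ENNReal))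
    (h_indep : IndepFun g b ℙ)
    (h_g : ∀ x y : U, x ≠ y → ∃ s, s < w ∧
      (∀ ω, (g ω y + 2 ^ wb - g ω x) % 2 ^ wb % 2 ^ s = 0) ∧
      (∀ v, v < 2 ^ (wb - s) →
        ℙ {ω | (g ω y + 2 ^ wb - g ω x) % 2 ^ wb / 2 ^ s = v}
          = 1 / (2 ^ (wb - s) : ENNReal))) :
    ∀ x y : U, x ≠ y → ∀ q r : ℕ, q < 2 ^ ℓ → r < 2 ^ ℓ →
      ℙ {ω | (g ω x + b ω) % 2 ^ wb / 2 ^ (wb - ℓ) = q ∧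
             (g ω y + b ω) % 2 ^ wb / 2 ^ (wb - ℓ) = r}
        = 1 / (2 ^ (2 * ℓ) : ENNReal) := by
  intro x y hxy q r hq hr
  obtain ⟨s, hs, hs0, hsu⟩ := h_g x y hxy
  set E : Ω → ℕ := fun ω => (g ω y + 2 ^ wb - g ω x) % 2 ^ wb / 2 ^ s with hE
  set A : Ω → ℕ := fun ω => (g ω x + b ω) % 2 ^ wb with hA
  have hgx : Measurable (fun ω => g ω x) := (measurable_pi_apply x).comp hg_meas
  have hgE : Measurable (fun G : U → ℕ => (G x, (G y + 2 ^ wb - G x) % 2 ^ wb / 2 ^ s)) := by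
    have h : Measurable (fun p : ℕ × ℕ => (p.1, (p.2 + 2 ^ wb - p.1) % 2 ^ wb / 2 ^ s)) :=
      Measurable.of_discrete
    have h' : Measurable (fun G : U → ℕ => (G x, G y)) :=
      (measurable_pi_apply x).prodMk (measurable_pi_apply y)
    exact h.comp h'
  have hEm : Measurable E := measurable_snd.comp (hgE.comp hg_meas)
  have hAm : Measurable A := by
    have h : Measurable (fun p : ℕ × ℕ => (p.1 + p.2) % 2 ^ wb) := Measurable.of_discrete
    exact h.comp (hgx.prodMk hb_meas)
  have hAlt : ∀ ω, A ω < 2 ^ wb := fun ω => Nat.mod_lt _ (by positivity)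
  have hsum : wb = s + (wb - s) := by omega
  have hELt : ∀ ω, E ω < 2 ^ (wb - s) := by
    intro ω
    apply Nat.div_lt_of_lt_mul
    rw [← pow_add, ← hsum]
    exact Nat.mod_lt _ (by positivity)
  have hind : IndepFun (fun ω => (g ω x, E ω)) b ℙ := h_indep.comp hgE measurable_id
  -- the joint distribution of `A` and `E`
  have joint : ∀ a < 2 ^ wb, ∀ e < 2 ^ (wb - s),
      ℙ {ω | A ω = a ∧ E ω = e} = 1 / (2 ^ wb : ENNReal) * (1 / (2 ^ (wb - s) : ENNReal)) := by
    intro a ha e he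
    rw [aux_split ℙ (fun ω => g ω x) hgx (2 ^ wb) (fun ω => hg_range ω x), ← hsu e he,
      aux_split ℙ (fun ω => g ω x) hgx (2 ^ wb) (fun ω => hg_range ω x) {ω | _ = e},
      Finset.mul_sum]
    refine Finset.sum_congr rfl fun u hu => ?_
    rw [Finset.mem_range] at hu
    have h := hind.measure_inter_preimage_eq_mul {(u, e)} {(a + 2 ^ wb - u) % 2 ^ wb}
      (measurableSet_singleton _) (measurableSet_singleton _)
    have hb := hb_unif ((a + 2 ^ wb - u) % 2 ^ wb) (Nat.mod_lt _ (by positivity))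
    rw [← hb, mul_comm]
    convert h using 2
    · ext ω
      simp only [Set.mem_ofPred_eq, Set.mem_inter_iff, Set.mem_preimage, Set.mem_singleton_iff,
        Prod.mk.injEq]
      constructor
      · rintro ⟨h1, h2, h3⟩
        refine ⟨⟨h1, h3⟩, ?_⟩
        rw [← aux_inv _ _ _ _ hu (hb_range ω) ha, ← h1]
        exact h2
      · rintro ⟨⟨h1, h3⟩, h2⟩
        refine ⟨h1, ?_, h3⟩
        rw [← aux_inv _ _ _ _ hu (hb_range ω) ha, ← h1] at h2
        exact h2
    · congr 1
      ext ω
      simp [hE]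
    · rfl
  have hev : ∀ ω, (g ω y + b ω) % 2 ^ wb / 2 ^ (wb - ℓ)
      = ((A ω / 2 ^ s + E ω) % 2 ^ (wb - s)) / 2 ^ (wb - ℓ - s) := by
    intro ω
    rw [← aux_reduce (2 ^ s) _ _ _ _ (by positivity), ← pow_add, ← pow_add, ← hsum,
      show s + (wb - ℓ - s) = wb - ℓ by omega]
    have hd : 2 ^ s * E ω = (g ω y + 2 ^ wb - g ω x) % 2 ^ wb :=
      Nat.mul_div_cancel' (Nat.dvd_of_mod_eq_zero (hs0 ω))
    rw [hd, aux_shift _ _ _ _ (hg_range ω x)]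
  have hcount : ∀ a, ((Finset.range (2 ^ (wb - s))).filter (fun e =>
      ((a / 2 ^ s + e) % 2 ^ (wb - s)) / 2 ^ (wb - ℓ - s) = r)).card = 2 ^ (wb - ℓ - s) := by
    intro a
    have h := aux_count (2 ^ (wb - ℓ - s)) (2 ^ ℓ) r (a / 2 ^ s) (by positivity) hr
    rwa [← pow_add, show wb - ℓ - s + ℓ = wb - s by omega] at h
  have hcountA : ((Finset.range (2 ^ wb)).filter (fun a => a / 2 ^ (wb - ℓ) = q)).card
      = 2 ^ (wb - ℓ) := by
    have h := aux_count0 (2 ^ (wb - ℓ)) (2 ^ ℓ) q (by positivity) hq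
    rwa [← pow_add, show wb - ℓ + ℓ = wb by omega] at h
  set c : ENNReal := 1 / (2 ^ wb : ENNReal) * (1 / (2 ^ (wb - s) : ENNReal)) with hc
  have key : ℙ {ω | (g ω x + b ω) % 2 ^ wb / 2 ^ (wb - ℓ) = q ∧
             (g ω y + b ω) % 2 ^ wb / 2 ^ (wb - ℓ) = r}
      = ∑ a ∈ Finset.range (2 ^ wb), if a / 2 ^ (wb - ℓ) = q then
          (∑ e ∈ Finset.range (2 ^ (wb - s)),
            if ((a / 2 ^ s + e) % 2 ^ (wb - s)) / 2 ^ (wb - ℓ - s) = r then c else 0) else 0 := by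
    rw [aux_split ℙ A hAm (2 ^ wb) hAlt]
    refine Finset.sum_congr rfl fun a ha => ?_
    rw [aux_split ℙ E hEm (2 ^ (wb - s)) hELt]
    split_ifs with h1
    · refine Finset.sum_congr rfl fun e he => ?_
      split_ifs with h2
      · rw [← joint a (Finset.mem_range.1 ha) e (Finset.mem_range.1 he)]
        congr 1
        ext ω
        simp only [Set.mem_ofPred_eq, hev]
        constructor
        · rintro ⟨h3, h4, -⟩; exact ⟨h4, h3⟩
        · rintro ⟨h3, h4⟩
          refine ⟨h4, h3, ?_, ?_⟩
          · rw [← h1, ← h3]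
          · rw [h3, h4, h2]
      · rw [← measure_empty (μ := (ℙ : Measure Ω))]
        congr 1
        ext ω
        simp only [Set.mem_ofPred_eq, hev, Set.mem_empty_iff_false, iff_false]
        rintro ⟨h3, h4, -, h5⟩
        rw [h3, h4] at h5
        exact h2 h5
    · refine Finset.sum_eq_zero fun e he => ?_
      rw [← measure_empty (μ := (ℙ : Measure Ω))]
      congr 1
      ext ω
      simp only [Set.mem_ofPred_eq, Set.mem_empty_iff_false, iff_false]
      rintro ⟨h3, h4, h5, -⟩
      apply h1
      rw [← h4]
      exact h5
  rw [key]
  simp only [← Finset.sum_filter, Finset.sum_const, hcount, hcountA, nsmul_eq_mul, hc]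
  push_cast
  have e1 : (2 : ENNReal) ^ wb = 2 ^ (wb - ℓ) * 2 ^ ℓ := by
    rw [← pow_add]; congr 1; omega
  have e2 : (2 : ENNReal) ^ (wb - s) = 2 ^ (wb - ℓ - s) * 2 ^ ℓ := by
    rw [← pow_add]; congr 1; omega
  have hne : ∀ n : ℕ, (2 : ENNReal) ^ n ≠ 0 := fun n => by positivity
  have hnt : ∀ n : ℕ, (2 : ENNReal) ^ n ≠ ⊤ := fun n => ENNReal.pow_ne_top (by simp)
  have e3 : (2 : ENNReal) ^ (2 * ℓ) = 2 ^ ℓ * 2 ^ ℓ := by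
    rw [← pow_add]; congr 1; omega
  rw [e1, e2, e3]
  simp only [one_div]
  rw [ENNReal.mul_inv (Or.inl (hne _)) (Or.inl (hnt _)),
    ENNReal.mul_inv (Or.inl (hne _)) (Or.inl (hnt _)),
    ENNReal.mul_inv (Or.inl (hne _)) (Or.inl (hnt _))]
  have i1 := ENNReal.mul_inv_cancel (hne (wb - ℓ)) (hnt _)
  have i2 := ENNReal.mul_inv_cancel (hne (wb - ℓ - s)) (hnt _)
  calc _ = ((2 : ENNReal) ^ (wb - ℓ) * (2 ^ (wb - ℓ))⁻¹)
        * ((2 : ENNReal) ^ (wb - ℓ - s) * (2 ^ (wb - ℓ - s))⁻¹)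
        * ((2 ^ ℓ)⁻¹ * (2 ^ ℓ)⁻¹) := by ring
    _ = _ := by rw [i1, i2, one_mul, one_mul]
end

section
/- Let w, ℓ, d be positive integers and w̄ ≥ w + ℓ − 1. For a₀,…,a_{d−1}, b chosen independently and uniformly at random from [2^w̄], the vector multiply-shift function h : [2^w]^d → [2^ℓ] defined by h(x₀,…,x_{d−1}) = ((Σ_{i∈[d]} a_i x_i) + b)[w̄−ℓ, w̄) is strongly universal: for any distinct vectors x, y ∈ [2^w]^d and any q,r ∈ [2^ℓ], Pr[h(x)=q ∧ h(y)=r] = 1/2^{2ℓ}. -/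
lemma vms_exists_mul (w ℓ wb : ℕ) (hw : 0 < w) (hwb : w + ℓ - 1 ≤ wb)
    (x y : ℕ) (hx : x < 2 ^ w) (hy : y < 2 ^ w) (hxy : x ≠ y) :
    ∃ t : ZMod (2 ^ wb), t * ((x : ZMod (2 ^ wb)) - y) = ((2 ^ (wb - ℓ) : ℕ) : ZMod (2 ^ wb)) := by
  set D : ℤ := (x : ℤ) - y with hD
  have hD0 : D ≠ 0 := by omega
  have hg : Int.gcd D ((2 ^ wb : ℕ) : ℤ) ∣ 2 ^ wb := by
    have := Int.gcd_dvd_right D ((2 ^ wb : ℕ) : ℤ)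
    exact_mod_cast this
  obtain ⟨k, hk, hgk⟩ := (Nat.dvd_prime_pow Nat.prime_two).1 hg
  have h1 : Int.gcd D ((2 ^ wb : ℕ) : ℤ) ∣ D.natAbs := by
    have := Int.gcd_dvd_left D ((2 ^ wb : ℕ) : ℤ)
    exact Int.natCast_dvd.1 this
  have h2 : 2 ^ k ≤ D.natAbs := by
    rw [← hgk]
    exact Nat.le_of_dvd (by omega) h1
  have h3 : 2 ^ k < 2 ^ w := by omega
  have h4 : k < w := (Nat.pow_lt_pow_iff_right (by norm_num)).1 h3
  have h5 : 2 ^ k ∣ 2 ^ (wb - ℓ) := pow_dvd_pow 2 (by omega)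
  obtain ⟨c, hc⟩ := h5
  have hb := Int.gcd_eq_gcd_ab D ((2 ^ wb : ℕ) : ℤ)
  rw [hgk] at hb
  have hb2 := congrArg (Int.cast : ℤ → ZMod (2 ^ wb)) hb
  rw [Int.cast_add, Int.cast_mul, Int.cast_mul, Int.cast_natCast, Int.cast_natCast,
    ZMod.natCast_self, zero_mul, add_zero, hD, Int.cast_sub, Int.cast_natCast,
    Int.cast_natCast] at hb2
  generalize Int.gcdA ((x : ℤ) - y) ((2 ^ wb : ℕ) : ℤ) = A at hb2
  refine ⟨(A : ZMod (2 ^ wb)) * (c : ZMod (2 ^ wb)), ?_⟩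
  rw [hc, Nat.cast_mul, hb2]
  ring

lemma vms_shift (M K L : ℕ) [NeZero M] (hK : 0 < K) (hM : M = K * L) (v : ZMod M) (q : ℕ)
    (hq : q < L) : (v + (q : ZMod M) * (K : ZMod M)).val / K = q ↔ v.val / K = 0 := by
  have hle : (q + 1) * K ≤ M := by rw [hM, mul_comm]; exact Nat.mul_le_mul_left _ hq
  have key : ∀ n < K, ((n : ZMod M)).val = n ∧
      ((n : ZMod M) + (q : ZMod M) * (K : ZMod M)).val = n + q * K := by
    intro n hn
    constructor
    · exact ZMod.val_cast_of_lt (by nlinarith)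
    · have : ((n : ZMod M) + (q : ZMod M) * (K : ZMod M)) = ((n + q * K : ℕ) : ZMod M) := by
        push_cast; ring
      rw [this]
      exact ZMod.val_cast_of_lt (by nlinarith)
  constructor
  · intro h
    set u := v + (q : ZMod M) * (K : ZMod M) with hu
    have h1 : u.val = u.val % K + q * K := by
      have := Nat.mod_add_div u.val K
      rw [h] at this
      rw [mul_comm q K]; exact this.symm
    have h2 : u = ((u.val % K : ℕ) : ZMod M) + (q : ZMod M) * (K : ZMod M) := by
      conv_lhs => rw [← ZMod.natCast_zmod_val u, h1]
      push_cast; ring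
    have h3 : v = ((u.val % K : ℕ) : ZMod M) := add_right_cancel (hu.symm.trans h2)
    rw [h3, (key _ (Nat.mod_lt _ hK)).1]
    exact Nat.div_eq_of_lt (Nat.mod_lt _ hK)
  · intro h
    have hlt : v.val < K := by
      rcases Nat.div_eq_zero_iff.1 h with h | h <;> omega
    have := (key _ hlt).2
    rw [ZMod.natCast_zmod_val] at this
    rw [this, Nat.add_mul_div_right _ _ hK, h, zero_add]

/-- counting in `ZMod M`. -/
lemma vms_count (M K L d : ℕ) [NeZero M] (hK : 0 < K) (hM : M = K * L)
    (x y : Fin d → ZMod M) (j : Fin d) (t : ZMod M) (ht : t * (x j - y j) = (K : ZMod M))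
    (q r : ℕ) (hq : q < L) (hr : r < L) :
    L * L * ((Finset.univ : Finset ((Fin d → ZMod M) × ZMod M)).filter
      (fun g => ((∑ i, g.1 i * x i) + g.2).val / K = q ∧
        ((∑ i, g.1 i * y i) + g.2).val / K = r)).card
      = Fintype.card ((Fin d → ZMod M) × ZMod M) := by
  classical
  set S : ℕ × ℕ → Finset ((Fin d → ZMod M) × ZMod M) := fun p =>
    (Finset.univ : Finset ((Fin d → ZMod M) × ZMod M)).filter
      (fun g => ((∑ i, g.1 i * x i) + g.2).val / K = p.1 ∧
        ((∑ i, g.1 i * y i) + g.2).val / K = p.2) with hS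
  have hcard : ∀ p ∈ Finset.range L ×ˢ Finset.range L, (S p).card = (S (0, 0)).card := by
    rintro ⟨q, r⟩ hp
    simp only [Finset.mem_product, Finset.mem_range] at hp
    symm
    let c : ZMod M := ((q : ZMod M) - r) * t
    let e : (Fin d → ZMod M) × ZMod M := (Pi.single j c, (r : ZMod M) * K - c * y j)
    have hsum : ∀ (g : (Fin d → ZMod M) × ZMod M) (z : Fin d → ZMod M),
        (∑ i, (g + e).1 i * z i) + (g + e).2
          = (∑ i, g.1 i * z i) + g.2 + (c * z j + ((r : ZMod M) * K - c * y j)) := by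
      intro g z
      have : ∑ i, (Pi.single j c : Fin d → ZMod M) i * z i = c * z j := by
        rw [Finset.sum_eq_single j]
        · simp
        · intro b _ hb; simp [hb]
        · simp
      simp only [e, Prod.fst_add, Prod.snd_add, Pi.add_apply, add_mul, Finset.sum_add_distrib,
        this]
      ring
    have hx' : c * x j + ((r : ZMod M) * K - c * y j) = (q : ZMod M) * K := by
      simp only [c]; rw [← ht]; ring
    have hy' : c * y j + ((r : ZMod M) * K - c * y j) = (r : ZMod M) * K := by ring
    refine Finset.card_equiv (Equiv.addRight e) ?_
    intro g
    simp only [hS, Finset.mem_filter, Finset.mem_univ, true_and, Equiv.coe_addRight, hsum, hx',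
      hy']
    rw [vms_shift M K L hK hM _ q hp.1, vms_shift M K L hK hM _ r hp.2]
  have htot : Fintype.card ((Fin d → ZMod M) × ZMod M)
      = ∑ p ∈ Finset.range L ×ˢ Finset.range L, (S p).card := by
    rw [← Finset.card_univ, Finset.card_eq_sum_card_fiberwise
      (f := fun g : (Fin d → ZMod M) × ZMod M => (((∑ i, g.1 i * x i) + g.2).val / K,
        ((∑ i, g.1 i * y i) + g.2).val / K)) (t := Finset.range L ×ˢ Finset.range L)]
    · refine Finset.sum_congr rfl fun p _ => ?_
      simp only [hS, Prod.ext_iff]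
    · intro g _
      have : ∀ v : ZMod M, v.val / K < L := fun v =>
        Nat.div_lt_of_lt_mul (lt_of_lt_of_eq (ZMod.val_lt v) hM)
      simp [this]
  rw [htot, Finset.sum_congr rfl hcard, Finset.sum_const, ← hcard (q, r) (by simp [hq, hr])]
  simp [hS]

/-- Vector multiply-shift: for `w̄ ≥ w + ℓ − 1` and seeds
`a₀,…,a_{d−1}, b` independent and uniform in `[2^w̄]`, the function
`h(x₀,…,x_{d−1}) = ((Σ_i a_i x_i) + b)[w̄−ℓ, w̄)` from `[2^w]^d` to `[2^ℓ]` is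
strongly universal: for distinct vectors `x, y` and any `q, r ∈ [2^ℓ]`,
`Pr[h(x) = q ∧ h(y) = r] = 1/2^(2ℓ)`. -/
theorem vector_multiply_shift_strongly_universal (w ℓ wb d : ℕ)
    (hw : 0 < w) (hℓ : 0 < ℓ) (hd : 0 < d) (hwb : w + ℓ - 1 ≤ wb)
    (x y : Fin d → ℕ) (hx : ∀ i, x i < 2 ^ w) (hy : ∀ i, y i < 2 ^ w) (hxy : x ≠ y)
    (q r : ℕ) (hq : q < 2 ^ ℓ) (hr : r < 2 ^ ℓ) :
    ((((Fintype.piFinset fun _ : Fin d => Finset.range (2 ^ wb)) ×ˢ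
        Finset.range (2 ^ wb)).filter
        (fun ab => ((∑ i, ab.1 i * x i) + ab.2) % 2 ^ wb / 2 ^ (wb - ℓ) = q ∧
                   ((∑ i, ab.1 i * y i) + ab.2) % 2 ^ wb / 2 ^ (wb - ℓ) = r)).card : ℚ)
      / (((Fintype.piFinset fun _ : Fin d => Finset.range (2 ^ wb)) ×ˢ
        Finset.range (2 ^ wb)).card : ℚ)
      = 1 / 2 ^ (2 * ℓ) := by
  classical
  obtain ⟨j, hj⟩ := Function.ne_iff.1 hxy
  obtain ⟨t, ht⟩ := vms_exists_mul w ℓ wb hw hwb (x j) (y j) (hx j) (hy j) hj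
  have hK : 0 < 2 ^ (wb - ℓ) := by positivity
  have hM : 2 ^ wb = 2 ^ (wb - ℓ) * 2 ^ ℓ := by rw [← pow_add]; congr 1; omega
  have hcount := vms_count (2 ^ wb) (2 ^ (wb - ℓ)) (2 ^ ℓ) d hK hM
    (fun i => (x i : ZMod (2 ^ wb))) (fun i => (y i : ZMod (2 ^ wb))) j t ht q r hq hr
  have hval : ∀ (ab : (Fin d → ℕ) × ℕ) (z : Fin d → ℕ),
      ((∑ i, (ab.1 i : ZMod (2 ^ wb)) * (z i : ZMod (2 ^ wb))) + (ab.2 : ZMod (2 ^ wb))).val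
        = ((∑ i, ab.1 i * z i) + ab.2) % 2 ^ wb := by
    intro ab z
    rw [← ZMod.val_natCast]
    push_cast
    rfl
  set F := (((Fintype.piFinset fun _ : Fin d => Finset.range (2 ^ wb)) ×ˢ
        Finset.range (2 ^ wb)).filter
        (fun ab => ((∑ i, ab.1 i * x i) + ab.2) % 2 ^ wb / 2 ^ (wb - ℓ) = q ∧
                   ((∑ i, ab.1 i * y i) + ab.2) % 2 ^ wb / 2 ^ (wb - ℓ) = r)) with hF
  have hFc : F.card = ((Finset.univ : Finset ((Fin d → ZMod (2 ^ wb)) × ZMod (2 ^ wb))).filter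
      (fun g => ((∑ i, g.1 i * (x i : ZMod (2 ^ wb))) + g.2).val / 2 ^ (wb - ℓ) = q ∧
        ((∑ i, g.1 i * (y i : ZMod (2 ^ wb))) + g.2).val / 2 ^ (wb - ℓ) = r)).card := by
    refine Finset.card_bij'
      (fun ab _ => ((fun i => (ab.1 i : ZMod (2 ^ wb))), (ab.2 : ZMod (2 ^ wb))))
      (fun g _ => ((fun i => (g.1 i).val), g.2.val)) ?_ ?_ ?_ ?_
    · intro ab hab
      have h := (Finset.mem_filter.1 hab).2
      rw [Finset.mem_filter]
      refine ⟨Finset.mem_univ _, ?_⟩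
      simp only [hval]
      exact h
    · intro g hg
      have h := (Finset.mem_filter.1 hg).2
      rw [hF, Finset.mem_filter]
      constructor
      · simp [Fintype.mem_piFinset, ZMod.val_lt]
      · rw [← hval, ← hval]
        simpa only [ZMod.natCast_zmod_val] using h
    · intro ab hab
      have h := (Finset.mem_filter.1 hab).1
      simp only [Finset.mem_product, Fintype.mem_piFinset, Finset.mem_range] at h
      ext i
      · exact ZMod.val_cast_of_lt (h.1 i)
      · exact ZMod.val_cast_of_lt h.2
    · intro g _
      ext i
      · exact ZMod.natCast_zmod_val _
      · exact ZMod.natCast_zmod_val _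
  have htot : ((Fintype.piFinset fun _ : Fin d => Finset.range (2 ^ wb)) ×ˢ
        Finset.range (2 ^ wb)).card = 2 ^ ℓ * 2 ^ ℓ * F.card := by
    rw [hFc, hcount]
    simp [ZMod.card]
  have hpos : 0 < ((Fintype.piFinset fun _ : Fin d => Finset.range (2 ^ wb)) ×ˢ
        Finset.range (2 ^ wb)).card := by
    simp
  have hFpos : (F.card : ℚ) ≠ 0 := by
    intro h0
    have : F.card = 0 := by exact_mod_cast h0
    rw [htot, this] at hpos
    simp at hpos
  rw [htot]
  push_cast
  rw [two_mul, pow_add]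
  field_simp
end

section
/- Let w, ℓ be positive integers, w̄ ≥ w + ℓ − 1, and let d be an even positive integer. For a₀,…,a_{d−1}, b chosen independently and uniformly at random from [2^w̄], the pair-multiply-shift function h : [2^w]^d → [2^ℓ] defined by h(x₀,…,x_{d−1}) = ((Σ_{i∈[d/2]} (a_{2i}+x_{2i+1})(a_{2i+1}+x_{2i})) + b)[w̄−ℓ, w̄) is strongly universal. -/
/-- Extend a vector `σ : Fin d → ℕ` to a function on all of `ℕ` (zero out of range).
All indices actually used below lie in range, so this is only a notational device. -/
def extendVec (d : ℕ) (σ : Fin d → ℕ) : ℕ → ℕ :=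
  fun j => if h : j < d then σ ⟨j, h⟩ else 0

namespace PMS

/-- ring-valued version of `extendVec`. -/
def ext {R : Type*} [CommRing R] (d : ℕ) (σ : Fin d → R) : ℕ → R :=
  fun j => if h : j < d then σ ⟨j, h⟩ else 0

/-- the pair sum -/
def F {R : Type*} [CommRing R] (n : ℕ) (A X : ℕ → R) : R :=
  ∑ i ∈ Finset.range n, (A (2 * i) + X (2 * i + 1)) * (A (2 * i + 1) + X (2 * i))

lemma F_diff {R : Type*} [CommRing R] (n : ℕ) (A X Y : ℕ → R) (j : ℕ) (hj : j < 2 * n) (c : R) :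
    F n (fun k => A k + if k = j then c else 0) X - F n (fun k => A k + if k = j then c else 0) Y
      = F n A X - F n A Y + c * (X j - Y j) := by
  have key : (F n (fun k => A k + if k = j then c else 0) X
      - F n (fun k => A k + if k = j then c else 0) Y) - (F n A X - F n A Y)
      = c * (X j - Y j) := by
    unfold F
    rw [← Finset.sum_sub_distrib, ← Finset.sum_sub_distrib, ← Finset.sum_sub_distrib]
    rw [Finset.sum_eq_single (j / 2)]
    · rcases Nat.even_or_odd' j with ⟨m, rfl | rfl⟩
      · have h1 : 2 * m / 2 = m := by omega
        have h2 : ¬ (2 * m + 1 = 2 * m) := by omega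
        simp only [h1, h2, if_true, if_false]
        ring
      · have h1 : (2 * m + 1) / 2 = m := by omega
        have h2 : ¬ (2 * m = 2 * m + 1) := by omega
        simp only [h1, h2, if_true, if_false]
        ring
    · intro i _ hi
      have h1 : ¬ (2 * i = j) := by omega
      have h2 : ¬ (2 * i + 1 = j) := by omega
      simp only [h1, h2, if_false]
      ring
    · intro h
      exact absurd (Finset.mem_range.2 (by omega)) h
  rw [← key]; ring

lemma top_shift (K L : ℕ) [NeZero (K * L)] (hK : 0 < K) (z : ZMod (K * L)) (k : ℕ) :
    (z + (k : ZMod (K * L)) * (K : ZMod (K * L))).val / K = (z.val / K + k) % L := by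
  have : z + (k : ZMod (K * L)) * (K : ZMod (K * L)) = ((z.val + k * K : ℕ) : ZMod (K * L)) := by
    push_cast; rw [ZMod.natCast_zmod_val]
  rw [this, ZMod.val_natCast, Nat.mod_mul_right_div_self, Nat.add_mul_div_right _ _ hK]

lemma exists_t (w ℓ wb : ℕ) (hw : 0 < w) (hℓ : 0 < ℓ) (hwb : w + ℓ - 1 ≤ wb) (u v : ℕ)
    (hu : u < 2 ^ w) (hv : v < 2 ^ w) (huv : u ≠ v) :
    ∃ t : ZMod (2 ^ wb), t * ((u : ZMod (2 ^ wb)) - v) = ((2 ^ (wb - ℓ) : ℕ) : ZMod (2 ^ wb)) := by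
  set δ : ℤ := (u : ℤ) - v with hδ
  have hδ0 : δ ≠ 0 := by omega
  have hlt : δ.natAbs < 2 ^ w := by omega
  have hg : Int.gcd δ ((2 ^ wb : ℕ) : ℤ) ∣ 2 ^ wb := by
    exact_mod_cast Int.gcd_dvd_right (a := δ) (b := ((2 ^ wb : ℕ) : ℤ))
  obtain ⟨s, hs, hgs⟩ := (Nat.dvd_prime_pow Nat.prime_two).1 hg
  have h1 : 2 ^ s ∣ δ.natAbs := by
    rw [← hgs]; exact Nat.gcd_dvd_left _ _
  have h2 : 2 ^ s ≤ δ.natAbs := Nat.le_of_dvd (by omega) h1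
  have h3 : s < w := (Nat.pow_lt_pow_iff_right (by norm_num : 1 < 2)).1 (lt_of_le_of_lt h2 hlt)
  have hb := Int.gcd_eq_gcd_ab δ ((2 ^ wb : ℕ) : ℤ)
  rw [hgs] at hb
  have hb' := congrArg (Int.cast : ℤ → ZMod (2 ^ wb)) hb
  rw [Int.cast_add, Int.cast_mul, Int.cast_mul, Int.cast_natCast (2 ^ wb), ZMod.natCast_self, zero_mul, add_zero,
    Int.cast_natCast] at hb'
  refine ⟨(2 ^ (wb - ℓ - s) : ℕ) * ((Int.gcdA δ ((2 ^ wb : ℕ) : ℤ) : ℤ) : ZMod (2 ^ wb)), ?_⟩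
  have h4 : 2 ^ (wb - ℓ) = 2 ^ (wb - ℓ - s) * 2 ^ s := by
    rw [← pow_add]; congr 1; omega
  rw [h4, Nat.cast_mul, hb', hδ]
  push_cast
  ring

/-- the counting set -/
def N (d K L : ℕ) [NeZero (K * L)] (X Y : ℕ → ZMod (K * L)) (q r : ℕ) :
    Finset ((Fin d → ZMod (K * L)) × ZMod (K * L)) :=
  Finset.univ.filter (fun p => (F (d / 2) (ext d p.1) X + p.2).val / K = q ∧
    (F (d / 2) (ext d p.1) Y + p.2).val / K = r)

lemma N_le (d K L : ℕ) [NeZero (K * L)] (hK : 0 < K) (hd : d % 2 = 0) (X Y : ℕ → ZMod (K * L))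
    (j : Fin d) (t : ZMod (K * L)) (ht : t * (X j - Y j) = K) (q r q' r' : ℕ)
    (hq : q < L) (hr : r < L) (hq' : q' < L) (hr' : r' < L) :
    (N d K L X Y q r).card ≤ (N d K L X Y q' r').card := by
  set k1 : ℕ := q' + L - q with hk1
  set k2 : ℕ := r' + L - r with hk2
  set c : ZMod (K * L) := ((k1 : ZMod (K * L)) - k2) * t with hc
  let sh : (Fin d → ZMod (K * L)) → (Fin d → ZMod (K * L)) :=
    fun a i => a i + if i = j then c else 0
  have hext : ∀ a, ext d (sh a) = fun k => ext d a k + if k = (j : ℕ) then c else 0 := by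
    intro a
    funext k
    by_cases hk : k < d
    · simp [ext, hk, sh, Fin.ext_iff]
    · have : k ≠ j := by have := j.2; omega
      simp [ext, hk, this]
  apply Finset.card_le_card_of_injOn (fun p => (sh p.1, p.2 + (k1 : ZMod (K * L)) * K
    - (F (d / 2) (ext d (sh p.1)) X - F (d / 2) (ext d p.1) X)))
  · rintro ⟨a, b⟩ hp
    simp only [N, Finset.coe_filter, Finset.mem_univ, true_and, Set.mem_ofPred_eq] at hp ⊢
    have hdiff := F_diff (d / 2) (ext d a) X Y j (by have := j.2; omega) c
    rw [← hext] at hdiff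
    have e1 : F (d / 2) (ext d (sh a)) X + (b + (k1 : ZMod (K * L)) * K
        - (F (d / 2) (ext d (sh a)) X - F (d / 2) (ext d a) X))
        = (F (d / 2) (ext d a) X + b) + (k1 : ZMod (K * L)) * K := by ring
    have e2 : F (d / 2) (ext d (sh a)) Y + (b + (k1 : ZMod (K * L)) * K
        - (F (d / 2) (ext d (sh a)) X - F (d / 2) (ext d a) X))
        = (F (d / 2) (ext d a) Y + b) + (k2 : ZMod (K * L)) * K := by
      rw [← ht]
      rw [hc] at hdiff
      linear_combination -hdiff
    rw [e1, e2, top_shift K L hK, top_shift K L hK, hp.1, hp.2]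
    constructor
    · rw [show q + k1 = q' + L by omega, Nat.add_mod_right, Nat.mod_eq_of_lt hq']
    · rw [show r + k2 = r' + L by omega, Nat.add_mod_right, Nat.mod_eq_of_lt hr']
  · rintro ⟨a, b⟩ _ ⟨a', b'⟩ _ h
    simp only [Prod.mk.injEq] at h
    have ha : a = a' := by
      funext i
      have := congrFun h.1 i
      simpa [sh] using this
    subst ha
    simpa using h.2

lemma N_total (d K L : ℕ) [NeZero (K * L)] (hK : 0 < K) (hd : d % 2 = 0) (X Y : ℕ → ZMod (K * L))
    (j : Fin d) (t : ZMod (K * L)) (ht : t * (X j - Y j) = K) (q r : ℕ)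
    (hq : q < L) (hr : r < L) :
    (L * L) * (N d K L X Y q r).card = (K * L) ^ d * (K * L) := by
  have htot : (Finset.univ : Finset ((Fin d → ZMod (K * L)) × ZMod (K * L))).card
      = (K * L) ^ d * (K * L) := by
    simp [ZMod.card]
  rw [← htot]
  have hlt : ∀ z : ZMod (K * L), z.val / K < L := fun z =>
    Nat.div_lt_of_lt_mul (ZMod.val_lt z)
  rw [Finset.card_eq_sum_card_fiberwise (s := Finset.univ) (t := Finset.range L ×ˢ Finset.range L)
    (f := fun p => ((F (d / 2) (ext d p.1) X + p.2).val / K,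
      (F (d / 2) (ext d p.1) Y + p.2).val / K))]
  · rw [Finset.sum_congr rfl (g := fun _ => (N d K L X Y q r).card)]
    · simp
    · rintro ⟨q', r'⟩ h
      simp only [Finset.mem_product, Finset.mem_range] at h
      have : (Finset.univ.filter (fun p : (Fin d → ZMod (K * L)) × ZMod (K * L) =>
          ((F (d / 2) (ext d p.1) X + p.2).val / K,
            (F (d / 2) (ext d p.1) Y + p.2).val / K) = (q', r'))) = N d K L X Y q' r' := by
        ext p; simp [N]
      rw [this]
      exact le_antisymm (N_le d K L hK hd X Y j t ht _ _ _ _ h.1 h.2 hq hr)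
        (N_le d K L hK hd X Y j t ht _ _ _ _ hq hr h.1 h.2)
  · intro p _
    simp [hlt]

lemma F_cast (M d n : ℕ) (a x : Fin d → ℕ) :
    ((∑ i ∈ Finset.range n, (extendVec d a (2 * i) + extendVec d x (2 * i + 1)) *
      (extendVec d a (2 * i + 1) + extendVec d x (2 * i)) : ℕ) : ZMod M)
    = F n (ext d (fun i => (a i : ZMod M))) (ext d (fun i => (x i : ZMod M))) := by
  have h : ∀ (σ : Fin d → ℕ) k, ((extendVec d σ k : ℕ) : ZMod M)
      = ext d (fun i => (σ i : ZMod M)) k := by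
    intro σ k
    unfold extendVec ext
    split_ifs <;> simp
  unfold F
  push_cast
  simp only [h]

end PMS

/-- Pair-multiply-shift: let `w̄ ≥ w + ℓ − 1` and `d` be even and
positive. For seeds `a₀,…,a_{d−1}, b` independent and uniform in `[2^w̄]`, the function
`h(x₀,…,x_{d−1}) = ((Σ_{i<d/2} (a_{2i} + x_{2i+1})(a_{2i+1} + x_{2i})) + b)[w̄−ℓ, w̄)`
from `[2^w]^d` to `[2^ℓ]` is strongly universal. -/
theorem pair_multiply_shift_strongly_universal (w ℓ wb d : ℕ)
    (hw : 0 < w) (hℓ : 0 < ℓ) (hd : 0 < d) (hdeven : d % 2 = 0) (hwb : w + ℓ - 1 ≤ wb)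
    (x y : Fin d → ℕ) (hx : ∀ i, x i < 2 ^ w) (hy : ∀ i, y i < 2 ^ w) (hxy : x ≠ y)
    (q r : ℕ) (hq : q < 2 ^ ℓ) (hr : r < 2 ^ ℓ) :
    ((((Fintype.piFinset fun _ : Fin d => Finset.range (2 ^ wb)) ×ˢ
        Finset.range (2 ^ wb)).filter
        (fun ab =>
          ((∑ i ∈ Finset.range (d / 2),
              (extendVec d ab.1 (2 * i) + extendVec d x (2 * i + 1)) *
                (extendVec d ab.1 (2 * i + 1) + extendVec d x (2 * i))) + ab.2)
            % 2 ^ wb / 2 ^ (wb - ℓ) = q ∧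
          ((∑ i ∈ Finset.range (d / 2),
              (extendVec d ab.1 (2 * i) + extendVec d y (2 * i + 1)) *
                (extendVec d ab.1 (2 * i + 1) + extendVec d y (2 * i))) + ab.2)
            % 2 ^ wb / 2 ^ (wb - ℓ) = r)).card : ℚ)
      / (((Fintype.piFinset fun _ : Fin d => Finset.range (2 ^ wb)) ×ˢ
        Finset.range (2 ^ wb)).card : ℚ)
      = 1 / 2 ^ (2 * ℓ) := by
  have hle : ℓ ≤ wb := by omega
  obtain ⟨j, hj⟩ := Function.ne_iff.1 hxy
  obtain ⟨t, ht⟩ := PMS.exists_t w ℓ wb hw hℓ hwb (x j) (y j) (hx j) (hy j) hj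
  have hM : 2 ^ wb = 2 ^ (wb - ℓ) * 2 ^ ℓ := by
    rw [← pow_add]; congr 1; omega
  have hL : 0 < 2 ^ ℓ := by positivity
  have hKpos : 0 < 2 ^ (wb - ℓ) := by positivity
  have h2 : (2 : ℚ) ^ (2 * ℓ) = ((2 ^ ℓ : ℕ) : ℚ) * ((2 ^ ℓ : ℕ) : ℚ) := by
    push_cast; ring
  rw [h2]
  generalize 2 ^ wb = M at *
  generalize 2 ^ ℓ = L at *
  generalize 2 ^ (wb - ℓ) = K at *
  subst hM
  have : NeZero (K * L) := ⟨by positivity⟩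
  have hN := PMS.N_total d K L hKpos hdeven (PMS.ext d (fun i => (x i : ZMod (K * L))))
    (PMS.ext d (fun i => (y i : ZMod (K * L)))) j t (by simpa [PMS.ext] using ht) q r hq hr
  rw [show (((Fintype.piFinset fun _ : Fin d => Finset.range (K * L)) ×ˢ
        Finset.range (K * L)).card) = (K * L) ^ d * (K * L) by simp, ← hN]
  have hpos : 0 < (K * L) ^ d * (K * L) := by positivity
  rw [← hN] at hpos
  have hcard : ∀ S : Finset ((Fin d → ℕ) × ℕ), S.card = (PMS.N d K L
      (PMS.ext d (fun i => (x i : ZMod (K * L)))) (PMS.ext d (fun i => (y i : ZMod (K * L))))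
      q r).card → (S.card : ℚ) / ((L * L * (PMS.N d K L
      (PMS.ext d (fun i => (x i : ZMod (K * L)))) (PMS.ext d (fun i => (y i : ZMod (K * L))))
      q r).card : ℕ) : ℚ) = 1 / ((L : ℚ) * L) := by
    intro S hS
    rw [hS]
    have h0 := Nat.pos_of_mul_pos_left hpos
    have h0' : ((PMS.N d K L
      (PMS.ext d (fun i => (x i : ZMod (K * L)))) (PMS.ext d (fun i => (y i : ZMod (K * L))))
      q r).card : ℚ) ≠ 0 := by positivity
    have : (L : ℚ) ≠ 0 := by positivity
    push_cast
    field_simp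
  apply hcard
  have hiff : ∀ (a : Fin d → ℕ) (b : ℕ) (z : Fin d → ℕ),
      (PMS.F (d / 2) (PMS.ext d (fun i => (a i : ZMod (K * L))))
        (PMS.ext d (fun i => (z i : ZMod (K * L)))) + (b : ZMod (K * L))).val
      = ((∑ i ∈ Finset.range (d / 2),
              (extendVec d a (2 * i) + extendVec d z (2 * i + 1)) *
                (extendVec d a (2 * i + 1) + extendVec d z (2 * i))) + b) % (K * L) := by
    intro a b z
    rw [← PMS.F_cast, ← Nat.cast_add, ZMod.val_natCast]
  apply Finset.card_nbij' (fun p => ((fun i => (p.1 i : ZMod (K * L))), (p.2 : ZMod (K * L))))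
    (fun p => ((fun i => (p.1 i).val), p.2.val))
  · rintro ⟨a, b⟩ h
    simp only [Finset.coe_filter, Set.mem_ofPred_eq] at h
    simp only [PMS.N, Finset.coe_filter, Finset.mem_univ, true_and, Set.mem_ofPred_eq, hiff]
    exact h.2
  · rintro ⟨a, b⟩ h
    simp only [PMS.N, Finset.coe_filter, Finset.mem_univ, true_and, Set.mem_ofPred_eq] at h
    simp only [Finset.coe_filter, Set.mem_ofPred_eq, Finset.mem_product, Fintype.mem_piFinset,
      Finset.mem_range, ← hiff, ZMod.natCast_zmod_val]
    exact ⟨⟨fun i => ZMod.val_lt _, ZMod.val_lt _⟩, h⟩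
  · rintro ⟨a, b⟩ h
    simp only [Finset.coe_filter, Set.mem_ofPred_eq, Finset.mem_product, Fintype.mem_piFinset,
      Finset.mem_range] at h
    simp only [ZMod.val_natCast, Prod.mk.injEq]
    exact ⟨funext fun i => Nat.mod_eq_of_lt (h.1.1 i), Nat.mod_eq_of_lt h.1.2⟩
  · rintro ⟨a, b⟩ h
    simp only [ZMod.natCast_zmod_val]
end
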